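/- Let ((a,b),(c,d)) be a matrix in SL₂(ℤ) and (λ,μ) ∈ ℤ². For (τ,z) ∈ D' such that the transformed point (τ',z') = ((aτ+b)/(cτ+d), (z+λτ+μ)/(cτ+d)) also lies in D', one has J₂(τ',z') = (cτ+d)²(J₂(τ,z) − 2λJ₁(τ,z) + λ²) + 2c(cτ+d)(z+λτ+μ)(J₁(τ,z) − λ) + c²(z+λτ+μ)². -/

import Mathlib

noncomputable section

open Complex MeasureTheory Set
open scoped ComplexConjugate

/-- `e w = exp (2 π i w)`. -/
def e (w : ℂ) : ℂ := Complex.exp (2 * (Real.pi : ℂ) * Complex.I * w)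

/-- The monomial `q^n ζ^r`, i.e. `(τ, z) ↦ e^{2πi(nτ + rz)}`. -/
def Qmon (n : ℕ) (r : ℤ) (τ z : ℂ) : ℂ := e ((n : ℂ) * τ + (r : ℂ) * z)

/-- `σ₁(n)`, the sum of the positive divisors of `n`. -/
def sigma1 (n : ℕ) : ℕ := ∑ d ∈ n.divisors, d

/-- The weight-2 Eisenstein series `E₂(τ) = 1 - 24 ∑_{n ≥ 1} σ₁(n) e^{2πinτ}`. -/
def E2 (τ : ℂ) : ℂ := 1 - 24 * ∑' n : ℕ, (sigma1 (n + 1) : ℂ) * e (((n : ℂ) + 1) * τ)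

/-- The deformed Eisenstein series
`J₁(τ,z) = ζ/(ζ-1) - 1/2 - ∑_{a,b ≥ 1} (ζ^a - ζ^{-a}) q^{ab}`. -/
def J1 (τ z : ℂ) : ℂ :=
  e z / (e z - 1) - 1 / 2 -
    ∑' p : ℕ × ℕ, (e (((p.1 : ℂ) + 1) * z) - e (-(((p.1 : ℂ) + 1) * z))) *
      e (((p.1 : ℂ) + 1) * ((p.2 : ℂ) + 1) * τ)

/-- The deformed Eisenstein series
`J₂(τ,z) = 1/6 - 2 ∑_{a,b ≥ 1} b (ζ^a + ζ^{-a}) q^{ab}`. -/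
def J2 (τ z : ℂ) : ℂ :=
  1 / 6 - 2 * ∑' p : ℕ × ℕ, ((p.2 : ℂ) + 1) *
      (e (((p.1 : ℂ) + 1) * z) + e (-(((p.1 : ℂ) + 1) * z))) *
      e (((p.1 : ℂ) + 1) * ((p.2 : ℂ) + 1) * τ)

/-- `D_τ = (1/2πi) ∂/∂τ`. -/
def Dt (φ : ℂ → ℂ → ℂ) : ℂ → ℂ → ℂ :=
  fun τ z => (1 / (2 * (Real.pi : ℂ) * Complex.I)) * deriv (fun t => φ t z) τ

/-- `D_z = (1/2πi) ∂/∂z`. -/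
def Dz (φ : ℂ → ℂ → ℂ) : ℂ → ℂ → ℂ :=
  fun τ z => (1 / (2 * (Real.pi : ℂ) * Complex.I)) * deriv (fun w => φ τ w) z

/-- The slash action `φ ↦ φ|_{k,m} γ` for `γ = ((a,b;c,d),(λ,μ)) ∈ Γ^J`. -/
def slash (k m : ℤ) (a b c d lam mu : ℤ) (φ : ℂ → ℂ → ℂ) (τ z : ℂ) : ℂ :=
  ((c : ℂ) * τ + (d : ℂ)) ^ (-k) *
    e ((m : ℂ) * (-(c : ℂ) * (z + (lam : ℂ) * τ + (mu : ℂ)) ^ 2 / ((c : ℂ) * τ + (d : ℂ)) +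
        (lam : ℂ) ^ 2 * τ + 2 * (lam : ℂ) * z)) *
    φ (((a : ℂ) * τ + (b : ℂ)) / ((c : ℂ) * τ + (d : ℂ)))
      ((z + (lam : ℂ) * τ + (mu : ℂ)) / ((c : ℂ) * τ + (d : ℂ)))

/-- The domain `D' = {(τ,z) : 0 < Im τ, |Im z| < Im τ, e^{2πiz} ≠ 1}`. -/
def D' : Set (ℂ × ℂ) := {p | 0 < p.1.im ∧ |p.2.im| < p.1.im ∧ e p.2 ≠ 1}

/-- The Oberdieck derivative `Oφ = D_τφ - (k/12)E₂φ - J₁D_zφ + mJ₂φ` of weight `k`, index `m`. -/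
def Ober (k m : ℕ) (φ : ℂ → ℂ → ℂ) : ℂ → ℂ → ℂ :=
  fun τ z => Dt φ τ z - ((k : ℂ) / 12) * E2 τ * φ τ z - J1 τ z * Dz φ τ z +
    (m : ℂ) * J2 τ z * φ τ z

/-- The heat operator `L_m = 4m D_τ - D_z²`. -/
def Heat (m : ℕ) (φ : ℂ → ℂ → ℂ) : ℂ → ℂ → ℂ :=
  fun τ z => 4 * (m : ℂ) * Dt φ τ z - Dz (Dz φ) τ z

/-- The modified heat operator `L_{k,m} = L_m - (m(2k-1)/6) E₂`. -/
def HeatE (k m : ℕ) (φ : ℂ → ℂ → ℂ) : ℂ → ℂ → ℂ :=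
  fun τ z => Heat m φ τ z - (m : ℂ) * (2 * (k : ℂ) - 1) / 6 * E2 τ * φ τ z

/-- The Jacobi–Serre derivative of weight `k` and index `m`. -/
def JSerre (k m : ℕ) (φ : ℂ → ℂ → ℂ) : ℂ → ℂ → ℂ :=
  fun τ z => Dt φ τ z - ((k : ℂ) / 12) * E2 τ * φ τ z +
    (1 / (1 - 4 * (m : ℂ))) *
      (Dz (Dz φ) τ z - J1 τ z * Dz φ τ z + (m : ℂ) * J2 τ z * φ τ z -
        ((m : ℂ) / 6) * E2 τ * φ τ z)

/-- The error function `erf a = (2/√π) ∫₀^a e^{-t²} dt`. -/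
def erf (a : ℝ) : ℝ := 2 / Real.sqrt Real.pi * ∫ t in (0 : ℝ)..a, Real.exp (-t ^ 2)

/-- Euler's integral for `₂F₁(1/2, k+1; 3/2; x)`:
`F_k(x) = (1/2) ∫₀¹ t^{-1/2} (1 - xt)^{-(k+1)} dt`. -/
def Fk (k x : ℝ) : ℝ := (1 / 2) * ∫ t in (0 : ℝ)..1, t ^ (-(1 : ℝ) / 2) * (1 - x * t) ^ (-(k + 1))

/-- The integration region `(u,v,x,y) ∈ [0,1] × (0,∞) × [0,1] × ℝ`. -/
def Reg : Set (ℝ × ℝ × ℝ × ℝ) := Icc 0 1 ×ˢ Ioi 0 ×ˢ Icc 0 1 ×ˢ univ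

/-- The Fourier series `φ(τ,z) = ∑_{n,r} c(n,r) q^n ζ^r`. -/
def phiF (c : ℕ → ℤ → ℂ) (τ z : ℂ) : ℂ :=
  ∑' p : ℕ × ℤ, c p.1 p.2 * e ((p.1 : ℂ) * τ + (p.2 : ℂ) * z)

section JacobiTransformation

open Filter Topology

lemma e_add (x y : ℂ) : e (x + y) = e x * e y := by
  simp [e, mul_add, Complex.exp_add]

lemma e_neg (x : ℂ) : e (-x) = (e x)⁻¹ := by
  simp [e, Complex.exp_neg]

lemma e_ne_zero (x : ℂ) : e x ≠ 0 := Complex.exp_ne_zero _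

lemma e_eq_one_iff {x : ℂ} : e x = 1 ↔ ∃ n : ℤ, x = n := by
  rw [e, Complex.exp_eq_one_iff]
  refine exists_congr fun n => ⟨fun h => ?_, fun h => by rw [h]; ring⟩
  apply mul_left_cancel₀ Complex.two_pi_I_ne_zero
  rw [h]; ring

lemma e_intCast (n : ℤ) : e n = 1 := e_eq_one_iff.2 ⟨n, rfl⟩

lemma e_nat_mul (n : ℕ) (x : ℂ) : e (n * x) = e x ^ n := by
  rw [e, e, ← Complex.exp_nat_mul]; ring_nf

lemma norm_e (x : ℂ) : ‖e x‖ = Real.exp (-(2 * Real.pi * x.im)) := by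
  rw [e, Complex.norm_exp]; simp

lemma hasDerivAt_e (x : ℂ) : HasDerivAt e (2 * Real.pi * I * e x) x := by
  have h := ((hasDerivAt_id x).const_mul (2 * (Real.pi : ℂ) * I)).cexp
  rw [show e = fun y => cexp (2 * Real.pi * I * id y) from rfl]
  simpa [mul_comm] using h

lemma differentiable_e : Differentiable ℂ e := fun x => (hasDerivAt_e x).differentiableAt

/-- The lattice `ℤτ + ℤ`. -/
def periodLattice (τ : ℂ) : Set ℂ := {z | ∃ m n : ℤ, z = m * τ + n}

lemma mem_periodLattice_iff {τ z : ℂ} (hτ : 0 < τ.im) : z ∈ periodLattice τ ↔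
    z.im / τ.im ∈ range ((↑) : ℤ → ℝ) ∧
      z.re - z.im / τ.im * τ.re ∈ range ((↑) : ℤ → ℝ) := by
  constructor
  · rintro ⟨m, n, rfl⟩
    have h : ((m : ℂ) * τ + n).im / τ.im = m := by simp [hτ.ne']
    rw [h]
    exact ⟨⟨m, rfl⟩, ⟨n, by simp⟩⟩
  · rintro ⟨⟨m, hm⟩, ⟨n, hn⟩⟩
    refine ⟨m, n, ?_⟩
    rw [← hm] at hn
    rw [eq_div_iff hτ.ne'] at hm
    apply Complex.ext
    · simp [hn]
    · simp [hm]

lemma isClosed_periodLattice {τ : ℂ} (hτ : 0 < τ.im) : IsClosed (periodLattice τ) := by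
  have h : periodLattice τ = (fun z : ℂ => z.im / τ.im) ⁻¹' range ((↑) : ℤ → ℝ) ∩
      (fun z : ℂ => z.re - z.im / τ.im * τ.re) ⁻¹' range ((↑) : ℤ → ℝ) := by
    ext z; exact mem_periodLattice_iff hτ
  have hZ := Int.isClosedEmbedding_coe_real.isClosed_range
  rw [h]
  exact (hZ.preimage (by fun_prop)).inter (hZ.preimage (by fun_prop))

lemma eventually_notMem_periodLattice {τ z : ℂ} (hτ : 0 < τ.im) (hz : z ∉ periodLattice τ) :
    ∀ᶠ w in 𝓝 z, w ∉ periodLattice τ :=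
  (isClosed_periodLattice hτ).isOpen_compl.mem_nhds hz

lemma eventually_notMem_periodLattice_zero {τ : ℂ} (hτ : 0 < τ.im) :
    ∀ᶠ w in 𝓝 (0 : ℂ), w ≠ 0 → w ∉ periodLattice τ := by
  have h1 : ∀ᶠ w : ℂ in 𝓝 0, |w.im / τ.im| < 1 := by
    refine ContinuousAt.eventually_lt (by fun_prop) (by fun_prop) (by simp)
  have h2 : ∀ᶠ w : ℂ in 𝓝 0, |w.re - w.im / τ.im * τ.re| < 1 := by
    refine ContinuousAt.eventually_lt (by fun_prop) (by fun_prop) (by simp)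
  filter_upwards [h1, h2] with w h1 h2 hw hmem
  obtain ⟨⟨m, hm⟩, ⟨n, hn⟩⟩ := (mem_periodLattice_iff hτ).1 hmem
  rw [← hm] at h1 hn
  rw [← hm, ← hn] at h2
  have hm0 : m = 0 := Int.abs_lt_one_iff.1 (by exact_mod_cast h1)
  have hn0 : n = 0 := Int.abs_lt_one_iff.1 (by exact_mod_cast h2)
  subst hm0 hn0
  have him : w.im = 0 := by
    have := (div_eq_iff hτ.ne').1 hm.symm
    simpa using this
  apply hw
  apply Complex.ext
  · simpa using hn.symm
  · simpa using him

lemma zero_mem_periodLattice (τ : ℂ) : (0 : ℂ) ∈ periodLattice τ := ⟨0, 0, by simp⟩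

lemma add_mem_periodLattice_iff {τ z : ℂ} (m n : ℤ) :
    z + m * τ + n ∈ periodLattice τ ↔ z ∈ periodLattice τ := by
  constructor
  · rintro ⟨k, l, h⟩
    exact ⟨k - m, l - n, by push_cast; linear_combination h⟩
  · rintro ⟨k, l, rfl⟩
    exact ⟨k + m, l + n, by push_cast; ring⟩

lemma neg_mem_periodLattice_iff {τ z : ℂ} : -z ∈ periodLattice τ ↔ z ∈ periodLattice τ := by
  constructor <;> rintro ⟨k, l, h⟩ <;> refine ⟨-k, -l, ?_⟩ <;> push_cast <;>
    linear_combination -h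

lemma e_ne_one_of_notMem {τ z : ℂ} (hz : z ∉ periodLattice τ) : e z ≠ 1 := fun h => by
  obtain ⟨n, rfl⟩ := e_eq_one_iff.1 h
  exact hz ⟨0, n, by simp⟩

lemma notMem_of_mem_D' {τ z : ℂ} (h : (τ, z) ∈ D') : z ∉ periodLattice τ := by
  rintro ⟨m, n, rfl⟩
  obtain ⟨h1, h2, h3⟩ := h
  dsimp only at h1 h2 h3
  have : |(m : ℝ)| < 1 := by
    have h4 : ((m : ℂ) * τ + n).im = m * τ.im := by simp
    rw [h4, abs_mul, abs_of_pos h1] at h2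
    exact lt_of_mul_lt_mul_right (by simpa using h2) h1.le
  have hm0 : m = 0 := Int.abs_lt_one_iff.1 (by exact_mod_cast this)
  subst hm0
  exact h3 (by simpa using e_intCast n)

/-- **Liouville's theorem for elliptic functions** whose only possible poles are at lattice points
and are at worst removable there. -/
theorem exists_const_of_elliptic {τ : ℂ} (hτ : 0 < τ.im) {f : ℂ → ℂ}
    (hd : ∀ z ∉ periodLattice τ, DifferentiableAt ℂ f z)
    (hf : ∀ z ∉ periodLattice τ, ∀ m n : ℤ, f (z + m * τ + n) = f z)
    (h0 : Tendsto (fun z => z * f z) (𝓝[≠] 0) (𝓝 0)) :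
    ∃ C, ∀ z ∉ periodLattice τ, f z = C := by
  classical
  set g : ℂ → ℂ := fun z => if z ∈ periodLattice τ then limUnder (𝓝[≠] 0) f else f z with hg
  have hper : ∀ z, ∀ m n : ℤ, g (z + m * τ + n) = g z := by
    intro z m n
    by_cases hz : z ∈ periodLattice τ
    · simp [hg, hz, (add_mem_periodLattice_iff m n).2 hz]
    · have : z + m * τ + n ∉ periodLattice τ := fun h => hz ((add_mem_periodLattice_iff m n).1 h)
      simp [hg, hz, this, hf z hz m n]
  have hg0 : DifferentiableAt ℂ g 0 := by
    have hs := eventually_notMem_periodLattice_zero hτ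
    set s : Set ℂ := {w | w ≠ 0 → w ∉ periodLattice τ}
    have hsm : s ∈ 𝓝 (0 : ℂ) := hs
    have ho : (fun z => f z - f 0) =o[𝓝[≠] 0] fun z => (z - 0)⁻¹ := by
      rw [Asymptotics.isLittleO_iff_tendsto']
      · have h1 : Tendsto (fun z : ℂ => z * f 0) (𝓝[≠] 0) (𝓝 0) := by
          have : ContinuousAt (fun z : ℂ => z * f 0) 0 := by fun_prop
          simpa using this.tendsto.mono_left nhdsWithin_le_nhds
        have h2 := h0.sub h1
        rw [sub_zero] at h2
        refine h2.congr fun z => ?_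
        simp; ring
      · filter_upwards [self_mem_nhdsWithin] with z hz h
        simp at h
        exact absurd h hz
    have hupd := Complex.differentiableOn_update_limUnder_of_isLittleO hsm
      (fun z hz => (hd z (hz.1 hz.2)).differentiableWithinAt) ho
    refine (hupd.differentiableAt hsm).congr_of_eventuallyEq ?_
    filter_upwards [hs] with w hw
    by_cases h : w = 0
    · subst h; simp [hg, zero_mem_periodLattice]
    · simp [hg, hw h, Function.update_of_ne h]
  have hgd : Differentiable ℂ g := by
    intro z
    by_cases hz : z ∈ periodLattice τ
    · obtain ⟨m, n, rfl⟩ := hz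
      have h1 : g = fun w => g (w - (m * τ + n)) := by
        funext w
        rw [← hper w (-m) (-n)]
        congr 1
        push_cast; ring
      rw [h1]
      refine DifferentiableAt.comp (g := g) (f := fun w => w - (m * τ + n)) _ ?_ (by fun_prop)
      simpa using hg0
    · refine (hd z hz).congr_of_eventuallyEq ?_
      filter_upwards [eventually_notMem_periodLattice hτ hz] with w hw
      simp [hg, hw]
  have hb : Bornology.IsBounded (range g) := by
    have hK : IsCompact ((fun p : ℝ × ℝ => (p.1 : ℂ) * τ + p.2) '' (Icc 0 1 ×ˢ Icc 0 1)) :=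
      (isCompact_Icc.prod isCompact_Icc).image (by fun_prop)
    refine (hK.image hgd.continuous).isBounded.subset ?_
    rintro _ ⟨z, rfl⟩
    set x := z.im / τ.im with hx
    set y := z.re - x * τ.re with hy
    refine ⟨_, ⟨(Int.fract x, Int.fract y), ⟨⟨Int.fract_nonneg _, (Int.fract_lt_one _).le⟩,
      ⟨Int.fract_nonneg _, (Int.fract_lt_one _).le⟩⟩, rfl⟩, ?_⟩
    have hz : z = x * τ + y := by
      apply Complex.ext
      · simp [hy]
      · simp [hx, hτ.ne']
    dsimp only
    rw [← hper _ ⌊x⌋ ⌊y⌋]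
    conv_rhs => rw [hz, ← Int.fract_add_floor x, ← Int.fract_add_floor y]
    congr 1
    push_cast; ring
  refine ⟨g 0, fun z hz => ?_⟩
  rw [← hgd.apply_eq_apply_of_bounded hb z 0]
  simp [hg, hz]

/-- `P w = e w / (1 - e w)`, the geometric series `∑_{a ≥ 1} (e w)^a` continued to the plane. -/
def geomE (w : ℂ) : ℂ := e w / (1 - e w)

/-- The sum `∑_{n ≥ 1} P (nτ + z)`. -/
def geomSum (τ z : ℂ) : ℂ := ∑' n : ℕ, geomE ((n + 1) * τ + z)

/-- The sum `∑_{n ≥ 1} n P (nτ + z)`. -/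
def weightedGeomSum (τ z : ℂ) : ℂ := ∑' n : ℕ, ((n : ℂ) + 1) * geomE ((n + 1) * τ + z)

/-- The meromorphic continuation of `J1 τ` to the plane. -/
def J1ext (τ z : ℂ) : ℂ := -geomE z - 1 / 2 - (geomSum τ z - geomSum τ (-z))

/-- The meromorphic continuation of `J2 τ` to the plane. -/
def J2ext (τ z : ℂ) : ℂ := 1 / 6 - 2 * (weightedGeomSum τ z + weightedGeomSum τ (-z))

lemma geomE_neg {z : ℂ} (hz : e z ≠ 1) : geomE (-z) = -1 - geomE z := by
  have h1 : e z - 1 ≠ 0 := sub_ne_zero.2 hz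
  have h2 : 1 - e z ≠ 0 := sub_ne_zero.2 hz.symm
  have h3 : 1 - (e z)⁻¹ ≠ 0 := by
    rw [sub_ne_zero]; intro h; exact hz (inv_eq_one.1 h.symm)
  have h4 := e_ne_zero z
  rw [geomE, geomE, e_neg]
  field_simp
  ring

lemma norm_e_lt_one {τ : ℂ} (hτ : 0 < τ.im) : ‖e τ‖ < 1 := by
  rw [norm_e, Real.exp_lt_one_iff]
  have := Real.pi_pos
  simp; positivity

lemma summable_succ_mul_geometric {𝕜 : Type*} [RCLike 𝕜] {r : 𝕜} (hr : ‖r‖ < 1) :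
    Summable fun n : ℕ => ((n : 𝕜) + 1) * r ^ (n + 1) := by
  have h : Summable fun n : ℕ => (n : 𝕜) ^ 1 * r ^ n :=
    summable_pow_mul_geometric_of_norm_lt_one 1 hr
  have h2 : Summable fun n : ℕ => ((n + 1 : ℕ) : 𝕜) ^ 1 * r ^ (n + 1) :=
    h.comp_injective (add_left_injective 1)
  simpa only [pow_one, Nat.cast_add, Nat.cast_one] using h2

lemma summable_weighted_geomE {τ : ℂ} (hτ : 0 < τ.im) (z : ℂ) :
    Summable fun n : ℕ => ((n : ℂ) + 1) * geomE ((n + 1) * τ + z) := by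
  have hq := norm_e_lt_one hτ
  have hpow : ∀ n : ℕ, e ((n + 1) * τ + z) = e τ ^ (n + 1) * e z := fun n => by
    rw [e_add, ← e_nat_mul]; push_cast; rfl
  have hlim : Tendsto (fun n : ℕ => e z / (1 - e τ ^ (n + 1) * e z)) atTop (𝓝 (e z)) := by
    have h1 := (tendsto_pow_atTop_nhds_zero_of_norm_lt_one hq).comp (tendsto_add_atTop_nat 1)
    have h2 : Tendsto (fun n : ℕ => e z / (1 - e τ ^ (n + 1) * e z)) atTop
        (𝓝 (e z / (1 - 0 * e z))) :=
      tendsto_const_nhds.div ((h1.mul_const (e z)).const_sub 1) (by simp)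
    rwa [zero_mul, sub_zero, div_one] at h2
  have hs : Summable fun n : ℕ => ((n : ℂ) + 1) * e τ ^ (n + 1) :=
    summable_succ_mul_geometric hq
  refine summable_of_isBigO_nat hs.norm (g := fun n : ℕ => ‖((n : ℂ) + 1) * e τ ^ (n + 1)‖) ?_
  have := (Asymptotics.isBigO_refl (fun n : ℕ => ((n : ℂ) + 1) * e τ ^ (n + 1)) atTop).mul
    (hlim.isBigO_one ℂ)
  refine (this.congr_left fun n => ?_).trans ?_
  · rw [geomE, hpow]; ring
  · simpa using (Asymptotics.isBigO_refl (fun n : ℕ => ((n : ℂ) + 1) * e τ ^ (n + 1)) atTop).norm_right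

lemma summable_geomE {τ : ℂ} (hτ : 0 < τ.im) (z : ℂ) :
    Summable fun n : ℕ => geomE ((n + 1) * τ + z) := by
  refine (summable_weighted_geomE hτ z).norm.of_norm_bounded fun n => ?_
  rw [norm_mul]
  refine le_mul_of_one_le_left (norm_nonneg _) ?_
  have : ((n : ℂ) + 1) = ((n + 1 : ℕ) : ℂ) := by push_cast; rfl
  rw [this, Complex.norm_natCast]
  exact_mod_cast Nat.le_add_left 1 n

lemma geomSum_add_self {τ : ℂ} (hτ : 0 < τ.im) (z : ℂ) :
    geomSum τ (z + τ) = geomSum τ z - geomE (z + τ) := by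
  rw [geomSum, geomSum, (summable_geomE hτ z).tsum_eq_zero_add, eq_sub_iff_add_eq, add_comm]
  congr 1
  · congr 1; push_cast; ring
  · refine tsum_congr fun n => ?_
    congr 1; push_cast; ring

lemma weightedGeomSum_add_self {τ : ℂ} (hτ : 0 < τ.im) (z : ℂ) :
    weightedGeomSum τ (z + τ) = weightedGeomSum τ z - geomSum τ z := by
  have h := (summable_weighted_geomE hτ z).sub (summable_geomE hτ z)
  rw [weightedGeomSum, weightedGeomSum, geomSum,
    ← (summable_weighted_geomE hτ z).tsum_sub (summable_geomE hτ z), h.tsum_eq_zero_add]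
  simp only [Nat.cast_zero, zero_add, one_mul, sub_self]
  refine tsum_congr fun n => ?_
  push_cast
  rw [show ((n : ℂ) + 1) * τ + (z + τ) = (n + 1 + 1) * τ + z by ring]
  ring

lemma J1ext_add_self {τ z : ℂ} (hτ : 0 < τ.im) (hz : e z ≠ 1) :
    J1ext τ (z + τ) = J1ext τ z - 1 := by
  have h1 := geomSum_add_self hτ z
  have h2 := geomSum_add_self hτ (-(z + τ))
  rw [show -(z + τ) + τ = -z by ring, geomE_neg hz] at h2
  rw [J1ext, J1ext]
  linear_combination -h1 - h2

lemma J2ext_add_self {τ z : ℂ} (hτ : 0 < τ.im) (hz : e z ≠ 1) :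
    J2ext τ (z + τ) = J2ext τ z - 2 * J1ext τ z + 1 := by
  have h1 := weightedGeomSum_add_self hτ z
  have h2 := geomSum_add_self hτ (-(z + τ))
  have h3 := weightedGeomSum_add_self hτ (-(z + τ))
  rw [show -(z + τ) + τ = -z by ring] at h2 h3
  rw [geomE_neg hz] at h2
  rw [J2ext, J2ext, J1ext]
  linear_combination -2 * h1 + 2 * h2 + 2 * h3

lemma geomE_add_intCast (z : ℂ) (n : ℤ) : geomE (z + n) = geomE z := by
  rw [geomE, geomE, e_add, e_intCast, mul_one]

lemma J1ext_add_intCast (τ z : ℂ) (n : ℤ) : J1ext τ (z + n) = J1ext τ z := by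
  have h : ∀ w : ℂ, ∀ k : ℤ, geomSum τ (w + k) = geomSum τ w := fun w k => by
    simp only [geomSum, ← add_assoc, geomE_add_intCast]
  have h2 := h (-z) (-n)
  rw [show -z + ((-n : ℤ) : ℂ) = -(z + n) by push_cast; ring] at h2
  rw [J1ext, J1ext, h, h2, geomE_add_intCast]

lemma J2ext_add_intCast (τ z : ℂ) (n : ℤ) : J2ext τ (z + n) = J2ext τ z := by
  have h : ∀ w : ℂ, ∀ k : ℤ, weightedGeomSum τ (w + k) = weightedGeomSum τ w := fun w k => by
    simp only [weightedGeomSum, ← add_assoc, geomE_add_intCast]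
  have h2 := h (-z) (-n)
  rw [show -z + ((-n : ℤ) : ℂ) = -(z + n) by push_cast; ring] at h2
  rw [J2ext, J2ext, h, h2]

lemma Jext_add_intCast_mul {τ z : ℂ} (hτ : 0 < τ.im) (hz : z ∉ periodLattice τ) (m : ℤ) :
    J1ext τ (z + m * τ) = J1ext τ z - m ∧
      J2ext τ (z + m * τ) = J2ext τ z - 2 * m * J1ext τ z + m ^ 2 := by
  have hne : ∀ k : ℤ, e (z + k * τ) ≠ 1 := fun k => e_ne_one_of_notMem fun h => hz <| by
    simpa using (add_mem_periodLattice_iff k 0).1 (by simpa using h)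
  induction m using Int.induction_on with
  | zero => simp
  | succ k ih =>
    have h1 := J1ext_add_self hτ (hne k)
    have h2 := J2ext_add_self hτ (hne k)
    rw [show z + (k : ℤ) * τ + τ = z + ((k + 1 : ℤ) : ℂ) * τ by push_cast; ring, ih.1] at h1
    rw [show z + (k : ℤ) * τ + τ = z + ((k + 1 : ℤ) : ℂ) * τ by push_cast; ring, ih.1, ih.2] at h2
    rw [h1, h2]
    constructor <;> push_cast <;> ring
  | pred k ih =>
    have h1 := J1ext_add_self hτ (hne (-k - 1))
    have h2 := J2ext_add_self hτ (hne (-k - 1))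
    rw [show z + ((-k - 1 : ℤ) : ℂ) * τ + τ = z + ((-k : ℤ) : ℂ) * τ by push_cast; ring] at h1 h2
    rw [ih.1] at h1
    rw [ih.2] at h2
    push_cast at h1 h2 ⊢
    constructor
    · linear_combination -h1
    · linear_combination -h2 - 2 * h1

lemma J1ext_add_period {τ z : ℂ} (hτ : 0 < τ.im) (hz : z ∉ periodLattice τ) (m n : ℤ) :
    J1ext τ (z + m * τ + n) = J1ext τ z - m := by
  rw [J1ext_add_intCast, (Jext_add_intCast_mul hτ hz m).1]

lemma J2ext_add_period {τ z : ℂ} (hτ : 0 < τ.im) (hz : z ∉ periodLattice τ) (m n : ℤ) :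
    J2ext τ (z + m * τ + n) = J2ext τ z - 2 * m * J1ext τ z + m ^ 2 := by
  rw [J2ext_add_intCast, (Jext_add_intCast_mul hτ hz m).2]

lemma J1ext_neg {τ z : ℂ} (hz : e z ≠ 1) : J1ext τ (-z) = -J1ext τ z := by
  rw [J1ext, J1ext, geomE_neg hz, neg_neg]; ring

/-- The `(a, b)`-term `ζ^a q^{ab}` with `a = p.1 + 1` and `b = p.2 + 1`. -/
def doubleTerm (τ : ℂ) (p : ℕ × ℕ) (z : ℂ) : ℂ :=
  e (((p.1 : ℂ) + 1) * (((p.2 : ℂ) + 1) * τ + z))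

lemma norm_doubleTerm_le {τ z : ℂ} {s : ℝ} (hs : 0 ≤ s) (hsτ : s < τ.im) (hz : -s < z.im)
    (p : ℕ × ℕ) :
    ‖doubleTerm τ p z‖ ≤ Real.exp (-(2 * Real.pi * (τ.im - s))) ^ (p.1 + p.2 + 1) := by
  rw [doubleTerm, norm_e, ← Real.exp_nat_mul, Real.exp_le_exp]
  obtain ⟨i, j⟩ := p
  have him : (((i : ℂ) + 1) * (((j : ℂ) + 1) * τ + z)).im
      = ((i : ℝ) + 1) * (((j : ℝ) + 1) * τ.im + z.im) := by simp
  dsimp only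
  rw [him]
  have hi : (0 : ℝ) ≤ i := i.cast_nonneg
  have hj : (0 : ℝ) ≤ j := j.cast_nonneg
  have hδ : 0 < τ.im - s := sub_pos.2 hsτ
  have h1 : ((i : ℝ) + j + 1) * (τ.im - s) ≤ ((i : ℝ) + 1) * (((j : ℝ) + 1) * τ.im + z.im) := by
    calc ((i : ℝ) + j + 1) * (τ.im - s) ≤ (((i : ℝ) + 1) * ((j : ℝ) + 1)) * (τ.im - s) := by
          gcongr; nlinarith [mul_nonneg hi hj]
      _ = ((i : ℝ) + 1) * (((j : ℝ) + 1) * (τ.im - s)) := by ring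
      _ ≤ ((i : ℝ) + 1) * (((j : ℝ) + 1) * τ.im + z.im) := by
          gcongr
          nlinarith [mul_nonneg hj hs]
  have := Real.pi_pos
  push_cast
  nlinarith [mul_le_mul_of_nonneg_left h1 (by positivity : 0 ≤ 2 * Real.pi)]

lemma summable_doubleTerm_bound {r : ℝ} (h0 : 0 ≤ r) (h1 : r < 1) :
    Summable fun p : ℕ × ℕ => ((p.2 : ℝ) + 1) * r ^ (p.1 + p.2 + 1) := by
  have hr : ‖r‖ < 1 := by rwa [Real.norm_of_nonneg h0]
  have hs : Summable fun n : ℕ => ((n : ℝ) + 1) * r ^ (n + 1) :=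
    summable_succ_mul_geometric hr
  refine ((summable_geometric_of_lt_one h0 h1).mul_of_nonneg hs (fun n => by positivity)
    (fun n => by positivity)).congr fun p => ?_
  ring

lemma exp_bound_lt_one {τ : ℂ} {s : ℝ} (hsτ : s < τ.im) :
    Real.exp (-(2 * Real.pi * (τ.im - s))) < 1 := by
  rw [Real.exp_lt_one_iff]
  have := mul_pos Real.two_pi_pos (sub_pos.2 hsτ)
  linarith

lemma norm_weighted_doubleTerm_le {τ z : ℂ} {s : ℝ} (hs : 0 ≤ s) (hsτ : s < τ.im)
    (hz : -s < z.im) (p : ℕ × ℕ) :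
    ‖((p.2 : ℂ) + 1) * doubleTerm τ p z‖ ≤
      ((p.2 : ℝ) + 1) * Real.exp (-(2 * Real.pi * (τ.im - s))) ^ (p.1 + p.2 + 1) := by
  have : ‖(p.2 : ℂ) + 1‖ = (p.2 : ℝ) + 1 := by
    rw [← Nat.cast_add_one, Complex.norm_natCast]; push_cast; rfl
  rw [norm_mul, this]
  gcongr
  exact norm_doubleTerm_le hs hsτ hz p

lemma norm_doubleTerm_le_weighted {τ z : ℂ} {s : ℝ} (hs : 0 ≤ s) (hsτ : s < τ.im)
    (hz : -s < z.im) (p : ℕ × ℕ) :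
    ‖doubleTerm τ p z‖ ≤
      ((p.2 : ℝ) + 1) * Real.exp (-(2 * Real.pi * (τ.im - s))) ^ (p.1 + p.2 + 1) :=
  (norm_doubleTerm_le hs hsτ hz p).trans <|
    le_mul_of_one_le_left (by positivity) (by linarith [p.2.cast_nonneg (α := ℝ)])

lemma exists_strip {τ z : ℂ} (hτ : 0 < τ.im) (hz : -τ.im < z.im) :
    ∃ s : ℝ, 0 ≤ s ∧ s < τ.im ∧ -s < z.im := by
  obtain ⟨s, h1, h2⟩ := exists_between (max_lt hτ (neg_lt.1 hz))
  exact ⟨s, (le_max_left _ _).trans h1.le, h2, neg_lt.1 ((le_max_right _ _).trans_lt h1)⟩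

lemma summable_weighted_doubleTerm {τ z : ℂ} (hτ : 0 < τ.im) (hz : -τ.im < z.im) :
    Summable fun p : ℕ × ℕ => ((p.2 : ℂ) + 1) * doubleTerm τ p z := by
  obtain ⟨s, hs, hsτ, hsz⟩ := exists_strip hτ hz
  exact (summable_doubleTerm_bound (Real.exp_pos _).le (exp_bound_lt_one hsτ)).of_norm_bounded
    (norm_weighted_doubleTerm_le hs hsτ hsz)

lemma summable_doubleTerm {τ z : ℂ} (hτ : 0 < τ.im) (hz : -τ.im < z.im) :
    Summable fun p : ℕ × ℕ => doubleTerm τ p z := by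
  obtain ⟨s, hs, hsτ, hsz⟩ := exists_strip hτ hz
  exact (summable_doubleTerm_bound (Real.exp_pos _).le (exp_bound_lt_one hsτ)).of_norm_bounded
    (norm_doubleTerm_le_weighted hs hsτ hsz)

lemma tsum_doubleTerm_fst {τ z : ℂ} (hτ : 0 < τ.im) (hz : -τ.im < z.im) (j : ℕ) :
    ∑' i : ℕ, doubleTerm τ (i, j) z = geomE ((j + 1) * τ + z) := by
  set w : ℂ := (j + 1) * τ + z with hw
  have hlt : ‖e w‖ < 1 := by
    rw [norm_e, Real.exp_lt_one_iff, neg_lt_zero]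
    refine mul_pos Real.two_pi_pos ?_
    have : w.im = (j + 1) * τ.im + z.im := by simp [hw]
    rw [this]
    nlinarith [mul_nonneg (j.cast_nonneg (α := ℝ)) hτ.le]
  have h : ∀ i : ℕ, doubleTerm τ (i, j) z = e w * e w ^ i := fun i => by
    rw [← pow_succ', ← e_nat_mul, doubleTerm]; push_cast; rfl
  simp_rw [h]
  rw [tsum_mul_left, tsum_geometric_of_norm_lt_one hlt, geomE, div_eq_mul_inv]

lemma geomSum_eq_tsum {τ z : ℂ} (hτ : 0 < τ.im) (hz : -τ.im < z.im) :
    geomSum τ z = ∑' p : ℕ × ℕ, doubleTerm τ p z := by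
  have hs := summable_doubleTerm hτ hz
  rw [hs.tsum_prod, ← Summable.tsum_comm (f := fun i j => doubleTerm τ (i, j) z) hs, geomSum]
  exact tsum_congr fun j => (tsum_doubleTerm_fst hτ hz j).symm

lemma weightedGeomSum_eq_tsum {τ z : ℂ} (hτ : 0 < τ.im) (hz : -τ.im < z.im) :
    weightedGeomSum τ z = ∑' p : ℕ × ℕ, ((p.2 : ℂ) + 1) * doubleTerm τ p z := by
  have hs := summable_weighted_doubleTerm hτ hz
  rw [hs.tsum_prod,
    ← Summable.tsum_comm (f := fun i j : ℕ => ((j : ℂ) + 1) * doubleTerm τ (i, j) z) hs,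
    weightedGeomSum]
  refine tsum_congr fun j => ?_
  rw [tsum_mul_left, tsum_doubleTerm_fst hτ hz j]

lemma hasDerivAt_doubleTerm (τ : ℂ) (p : ℕ × ℕ) (z : ℂ) :
    HasDerivAt (doubleTerm τ p) (2 * Real.pi * I * (((p.1 : ℂ) + 1) * doubleTerm τ p z)) z := by
  have h1 : HasDerivAt (fun w : ℂ => ((p.1 : ℂ) + 1) * (((p.2 : ℂ) + 1) * τ + w))
      ((p.1 : ℂ) + 1) z := by
    simpa using ((hasDerivAt_id z).const_add (((p.2 : ℂ) + 1) * τ)).const_mul ((p.1 : ℂ) + 1)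
  refine ((hasDerivAt_e _).comp z h1).congr_deriv ?_
  rw [doubleTerm]; ring

lemma differentiableAt_geomSum {τ z : ℂ} (hτ : 0 < τ.im) (hz : -τ.im < z.im) :
    DifferentiableAt ℂ (geomSum τ) z := by
  obtain ⟨s, hs, hsτ, hsz⟩ := exists_strip hτ hz
  have h := differentiableOn_tsum_of_summable_norm
    (summable_doubleTerm_bound (Real.exp_pos _).le (exp_bound_lt_one hsτ))
    (fun p w _ => (hasDerivAt_doubleTerm τ p w).differentiableAt.differentiableWithinAt)
    (isOpen_im_gt (-s)) (fun p w hw => norm_doubleTerm_le_weighted hs hsτ hw p)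
  refine (h.differentiableAt ((isOpen_im_gt (-s)).mem_nhds hsz)).congr_of_eventuallyEq ?_
  filter_upwards [(isOpen_im_gt (-τ.im)).mem_nhds hz] with w hw using geomSum_eq_tsum hτ hw

lemma differentiableAt_weightedGeomSum {τ z : ℂ} (hτ : 0 < τ.im) (hz : -τ.im < z.im) :
    DifferentiableAt ℂ (weightedGeomSum τ) z := by
  obtain ⟨s, hs, hsτ, hsz⟩ := exists_strip hτ hz
  have h := differentiableOn_tsum_of_summable_norm
    (F := fun (p : ℕ × ℕ) z => ((p.2 : ℂ) + 1) * doubleTerm τ p z)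
    (summable_doubleTerm_bound (Real.exp_pos _).le (exp_bound_lt_one hsτ))
    (fun p w _ =>
      ((hasDerivAt_doubleTerm τ p w).const_mul _).differentiableAt.differentiableWithinAt)
    (isOpen_im_gt (-s)) (fun p w hw => norm_weighted_doubleTerm_le hs hsτ hw p)
  refine (h.differentiableAt ((isOpen_im_gt (-s)).mem_nhds hsz)).congr_of_eventuallyEq ?_
  filter_upwards [(isOpen_im_gt (-τ.im)).mem_nhds hz] with w hw using weightedGeomSum_eq_tsum hτ hw

lemma deriv_geomSum_zero {τ : ℂ} (hτ : 0 < τ.im) :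
    deriv (geomSum τ) 0 = 2 * Real.pi * I * weightedGeomSum τ 0 := by
  have hz : -τ.im < (0 : ℂ).im := by simpa using hτ
  obtain ⟨s, hs, hsτ, hsz⟩ := exists_strip hτ hz
  have h := hasSum_deriv_of_summable_norm
    (summable_doubleTerm_bound (Real.exp_pos _).le (exp_bound_lt_one hsτ))
    (fun p w _ => (hasDerivAt_doubleTerm τ p w).differentiableAt.differentiableWithinAt)
    (isOpen_im_gt (-s)) (fun p w hw => norm_doubleTerm_le_weighted hs hsτ hw p) hsz
  have heq : geomSum τ =ᶠ[𝓝 0] fun w => ∑' p : ℕ × ℕ, doubleTerm τ p w := by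
    filter_upwards [(isOpen_im_gt (-τ.im)).mem_nhds hz] with w hw using geomSum_eq_tsum hτ hw
  rw [heq.deriv_eq, ← h.tsum_eq, weightedGeomSum_eq_tsum hτ hz, ← tsum_mul_left,
    ← (Equiv.prodComm ℕ ℕ).tsum_eq]
  refine tsum_congr fun p => ?_
  rw [(hasDerivAt_doubleTerm τ _ 0).deriv]
  simp only [Equiv.prodComm_apply, Prod.fst_swap, Prod.snd_swap, doubleTerm]
  ring_nf

lemma J1ext_eq {τ z : ℂ} (hτ : 0 < τ.im) (hz : |z.im| < τ.im) : J1ext τ z = J1 τ z := by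
  obtain ⟨h1, h2⟩ := abs_lt.1 hz
  have h3 : -τ.im < (-z).im := by simpa using h2
  rw [J1ext, J1, geomSum_eq_tsum hτ h1, geomSum_eq_tsum hτ h3,
    ← (summable_doubleTerm hτ h1).tsum_sub (summable_doubleTerm hτ h3)]
  congr 1
  · rw [geomE, ← div_neg, neg_sub]
  · refine tsum_congr fun p => ?_
    rw [sub_mul, ← e_add, ← e_add, doubleTerm, doubleTerm]
    ring_nf

lemma J2ext_eq {τ z : ℂ} (hτ : 0 < τ.im) (hz : |z.im| < τ.im) : J2ext τ z = J2 τ z := by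
  obtain ⟨h1, h2⟩ := abs_lt.1 hz
  have h3 : -τ.im < (-z).im := by simpa using h2
  rw [J2ext, J2, weightedGeomSum_eq_tsum hτ h1, weightedGeomSum_eq_tsum hτ h3,
    ← (summable_weighted_doubleTerm hτ h1).tsum_add (summable_weighted_doubleTerm hτ h3)]
  congr 2
  refine tsum_congr fun p => ?_
  rw [← mul_add, mul_assoc, add_mul (e _), ← e_add, ← e_add, doubleTerm, doubleTerm]
  ring_nf

lemma differentiableAt_geomE {z : ℂ} (hz : e z ≠ 1) : DifferentiableAt ℂ geomE z :=
  (differentiable_e z).div ((differentiable_e z).const_sub 1) (sub_ne_zero.2 hz.symm)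

lemma differentiableAt_geomSum_neg {τ z : ℂ} (hτ : 0 < τ.im) (hz : z.im < τ.im) :
    DifferentiableAt ℂ (fun w => geomSum τ (-w)) z :=
  DifferentiableAt.comp (g := geomSum τ) (f := fun w => -w) z
    (differentiableAt_geomSum hτ (by simpa using hz)) (by fun_prop)

lemma differentiableAt_J2ext_of_strip {τ z : ℂ} (hτ : 0 < τ.im) (hz : |z.im| < τ.im) :
    DifferentiableAt ℂ (J2ext τ) z := by
  obtain ⟨h1, h2⟩ := abs_lt.1 hz
  have h3 : DifferentiableAt ℂ (fun w => weightedGeomSum τ (-w)) z :=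
    DifferentiableAt.comp (g := weightedGeomSum τ) (f := fun w => -w) z
      (differentiableAt_weightedGeomSum hτ (by simpa using h2)) (by fun_prop)
  exact (((differentiableAt_weightedGeomSum hτ h1).add h3).const_mul 2).const_sub (1 / 6)

lemma differentiableAt_J1ext_of_strip {τ z : ℂ} (hτ : 0 < τ.im) (hz : |z.im| < τ.im)
    (he : e z ≠ 1) : DifferentiableAt ℂ (J1ext τ) z := by
  obtain ⟨h1, h2⟩ := abs_lt.1 hz
  exact ((differentiableAt_geomE he).neg.sub_const (1 / 2)).sub
    ((differentiableAt_geomSum hτ h1).sub (differentiableAt_geomSum_neg hτ h2))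

lemma differentiableAt_Jext {τ z : ℂ} (hτ : 0 < τ.im) (hz : z ∉ periodLattice τ) :
    DifferentiableAt ℂ (J1ext τ) z ∧ DifferentiableAt ℂ (J2ext τ) z := by
  set k : ℤ := ⌊z.im / τ.im⌋ with hk
  set w : ℂ := z + (-k : ℤ) * τ with hw
  have hwz : ∀ u : ℂ, u + (-k : ℤ) * τ ∉ periodLattice τ ↔ u ∉ periodLattice τ := fun u => by
    simpa using (add_mem_periodLattice_iff (τ := τ) (z := u) (-k) 0).not
  have hwim : |w.im| < τ.im := by
    have h : w.im = Int.fract (z.im / τ.im) * τ.im := by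
      rw [Int.fract, ← hk, sub_mul, div_mul_cancel₀ _ hτ.ne']
      simp [hw]; ring
    rw [h, abs_of_nonneg (mul_nonneg (Int.fract_nonneg _) hτ.le)]
    exact mul_lt_of_lt_one_left hτ (Int.fract_lt_one _)
  have h1 := differentiableAt_J1ext_of_strip hτ hwim (e_ne_one_of_notMem ((hwz z).2 hz))
  have h2 := differentiableAt_J2ext_of_strip hτ hwim
  have h1' : DifferentiableAt ℂ (fun u => J1ext τ (u + (-k : ℤ) * τ)) z :=
    DifferentiableAt.comp (g := J1ext τ) (f := fun u => u + (-k : ℤ) * τ) z h1 (by fun_prop)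
  have h2' : DifferentiableAt ℂ (fun u => J2ext τ (u + (-k : ℤ) * τ)) z :=
    DifferentiableAt.comp (g := J2ext τ) (f := fun u => u + (-k : ℤ) * τ) z h2 (by fun_prop)
  have hev := eventually_notMem_periodLattice hτ hz
  have hshift : ∀ u : ℂ, u + (-k : ℤ) * τ + k * τ = u := fun u => by push_cast; ring
  constructor
  · refine (h1'.sub_const (k : ℂ)).congr_of_eventuallyEq ?_
    filter_upwards [hev] with u hu
    have := (Jext_add_intCast_mul hτ ((hwz u).2 hu) k).1
    rwa [hshift] at this
  · refine ((h2'.sub (h1'.const_mul (2 * (k : ℂ)))).add_const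
      ((k : ℂ) ^ 2)).congr_of_eventuallyEq ?_
    filter_upwards [hev] with u hu
    have := (Jext_add_intCast_mul hτ ((hwz u).2 hu) k).2
    rwa [hshift] at this

/-- The first coefficient of the expansion of `1 / (1 - e^{-w}) - 1/2 - 1/w` at `0`. -/
lemma tendsto_exp_div_exp_sub_one :
    Tendsto (fun w : ℂ => (cexp w / (cexp w - 1) - 1 / 2 - 1 / w) / w) (𝓝[≠] 0) (𝓝 (1 / 12)) := by
  set ρ : ℂ → ℂ := fun w => (cexp w - (1 + w + w ^ 2 / 2 + w ^ 3 / 6)) / w ^ 3 with hρ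
  have hρ0 : Tendsto ρ (𝓝[≠] 0) (𝓝 0) := by
    have h := (Complex.exp_sub_sum_range_succ_isLittleO_pow 3).tendsto_div_nhds_zero
    refine (h.mono_left nhdsWithin_le_nhds).congr fun w => ?_
    simp [hρ, Finset.sum_range_succ, Nat.factorial]
  have hid : Tendsto (fun w : ℂ => w) (𝓝[≠] 0) (𝓝 0) := tendsto_id.mono_left nhdsWithin_le_nhds
  have hden : Tendsto (fun w => 1 + w / 2 + w ^ 2 / 6 + w ^ 2 * ρ w) (𝓝[≠] 0) (𝓝 1) := by
    simpa using (((hid.div_const 2).const_add 1).add ((hid.pow 2).div_const 6)).add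
      ((hid.pow 2).mul hρ0)
  have hnum : Tendsto (fun w => 1 / 12 + w / 12 + w * ρ w / 2 - ρ w) (𝓝[≠] 0) (𝓝 (1 / 12)) := by
    have h := (((hid.div_const 12).const_add (1 / 12)).add ((hid.mul hρ0).div_const 2)).sub hρ0
    simpa only [zero_mul, zero_div, add_zero, sub_zero] using h
  have hdiv := hnum.div hden one_ne_zero
  rw [div_one] at hdiv
  refine hdiv.congr' ?_
  filter_upwards [self_mem_nhdsWithin, hden.eventually_ne one_ne_zero] with w hw hD
  have hw0 : w ≠ 0 := hw
  have hexp : cexp w = 1 + w + w ^ 2 / 2 + w ^ 3 / 6 + w ^ 3 * ρ w := by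
    simp only [hρ]; field_simp; ring
  have hexp1 : cexp w - 1 = w * (1 + w / 2 + w ^ 2 / 6 + w ^ 2 * ρ w) := by rw [hexp]; ring
  rw [Pi.div_apply, hexp1, hexp]
  generalize hD' : 1 + w / 2 + w ^ 2 / 6 + w ^ 2 * ρ w = D at hD
  generalize ρ w = r at hD'
  field_simp
  subst hD'
  ring

lemma J2ext_zero (τ : ℂ) : J2ext τ 0 = 1 / 6 - 4 * weightedGeomSum τ 0 := by
  rw [J2ext, neg_zero]; ring

lemma tendsto_ne_mul_const {k : ℂ} (hk : k ≠ 0) :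
    Tendsto (fun z : ℂ => k * z) (𝓝[≠] 0) (𝓝[≠] 0) := by
  refine tendsto_nhdsWithin_iff.2 ⟨?_, ?_⟩
  · have : ContinuousAt (fun z : ℂ => k * z) 0 := by fun_prop
    simpa using this.tendsto.mono_left nhdsWithin_le_nhds
  · filter_upwards [self_mem_nhdsWithin] with z hz
    exact mul_ne_zero hk hz

/-- The Laurent expansion `J₁(τ, z) = 1/(2πiz) + πi J₂(τ, 0) z + o(z)` at `z = 0`. -/
lemma tendsto_J1ext_sub_div {τ : ℂ} (hτ : 0 < τ.im) :
    Tendsto (fun z => (J1ext τ z - 1 / (2 * Real.pi * I * z)) / z) (𝓝[≠] 0)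
      (𝓝 (Real.pi * I * J2ext τ 0)) := by
  have h1 := (tendsto_exp_div_exp_sub_one.comp
    (tendsto_ne_mul_const Complex.two_pi_I_ne_zero)).const_mul (2 * (Real.pi : ℂ) * I)
  have hd : DifferentiableAt ℂ (geomSum τ) 0 := differentiableAt_geomSum hτ (by simpa using hτ)
  have hA := hd.hasDerivAt
  rw [deriv_geomSum_zero hτ] at hA
  have hA' : HasDerivAt (fun w => geomSum τ (-w)) (-(2 * Real.pi * I * weightedGeomSum τ 0)) 0 := by
    have h0 : HasDerivAt (geomSum τ) (2 * Real.pi * I * weightedGeomSum τ 0) (-0) := by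
      rwa [neg_zero]
    have h := h0.comp (0 : ℂ) (hasDerivAt_neg (0 : ℂ))
    rw [mul_neg_one] at h
    exact h
  have h2 := hasDerivAt_iff_tendsto_slope.1 (hA.sub hA')
  have h3 := h1.sub h2
  rw [J2ext_zero]
  convert h3.congr' ?_ using 2
  · ring
  · filter_upwards [self_mem_nhdsWithin] with z hz
    have hz0 : z ≠ 0 := hz
    have hpi := Complex.two_pi_I_ne_zero
    have hg : geomE z = -(cexp (2 * Real.pi * I * z) / (cexp (2 * Real.pi * I * z) - 1)) := by
      rw [geomE, ← div_neg, neg_sub]; rfl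
    simp only [Function.comp_apply, slope_def_field, J1ext, hg, Pi.sub_apply, neg_zero, sub_self,
      sub_zero]
    generalize cexp (2 * Real.pi * I * z) / (cexp (2 * Real.pi * I * z) - 1) = x
    generalize (2 * (Real.pi : ℂ) * I) = y at hpi
    field_simp
    ring

lemma tendsto_mul_J1ext {τ : ℂ} (hτ : 0 < τ.im) :
    Tendsto (fun z => z * J1ext τ z) (𝓝[≠] 0) (𝓝 (1 / (2 * Real.pi * I))) := by
  have hid : Tendsto (fun w : ℂ => w) (𝓝[≠] 0) (𝓝 0) := tendsto_id.mono_left nhdsWithin_le_nhds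
  have h := ((hid.pow 2).mul (tendsto_J1ext_sub_div hτ)).add_const (1 / (2 * Real.pi * I))
  have hpi := Complex.two_pi_I_ne_zero
  refine (by simpa using h : Tendsto _ _ (𝓝 (1 / (2 * Real.pi * I)))).congr' ?_
  filter_upwards [self_mem_nhdsWithin] with z hz
  have hz0 : z ≠ 0 := hz
  field_simp
  ring

section Modular

variable {a b c d : ℤ} {τ τ' j : ℂ}

lemma automorphyFactor_ne_zero (hdet : a * d - b * c = 1) (hτ : 0 < τ.im)
    (hj : j = c * τ + d) : j ≠ 0 := by
  rintro rfl
  have h1 : (c : ℝ) * τ.im = 0 := by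
    have := congrArg Complex.im hj
    simpa using this.symm
  have hc : c = 0 := by
    rcases mul_eq_zero.1 h1 with h | h
    · exact_mod_cast h
    · exact absurd h hτ.ne'
  subst hc
  have hd : d = 0 := by
    have : (d : ℂ) = 0 := by simpa using hj.symm
    exact_mod_cast this
  subst hd
  simp at hdet

lemma add_period_div (hdet : a * d - b * c = 1) (hj : j = c * τ + d) (hj0 : j ≠ 0)
    (hτj : τ' * j = a * τ + b) (z : ℂ) (m n : ℤ) :
    (z + m * τ + n) / j = z / j + ((m * d - n * c : ℤ) : ℂ) * τ' + ((n * a - m * b : ℤ) : ℂ) := by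
  have hdet' : (a : ℂ) * d - b * c = 1 := by exact_mod_cast hdet
  rw [div_eq_iff hj0, add_mul, add_mul, div_mul_cancel₀ _ hj0, mul_assoc, hτj, hj]
  push_cast
  linear_combination (-(m * τ + n : ℂ)) * hdet'

lemma div_mem_periodLattice_iff (hdet : a * d - b * c = 1) (hj : j = c * τ + d) (hj0 : j ≠ 0)
    (hτj : τ' * j = a * τ + b) {z : ℂ} : z / j ∈ periodLattice τ' ↔ z ∈ periodLattice τ := by
  constructor
  · rintro ⟨m, n, h⟩
    refine ⟨m * a + n * c, m * b + n * d, ?_⟩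
    rw [div_eq_iff hj0, add_mul, mul_assoc, hτj, hj] at h
    rw [h]; push_cast; ring
  · rintro ⟨m, n, rfl⟩
    have := add_period_div hdet hj hj0 hτj 0 m n
    rw [zero_add, zero_div, zero_add] at this
    exact ⟨_, _, this⟩

lemma tendsto_div_const_punctured (hj0 : j ≠ 0) :
    Tendsto (fun z : ℂ => z / j) (𝓝[≠] 0) (𝓝[≠] 0) := by
  simpa only [div_eq_inv_mul] using tendsto_ne_mul_const (inv_ne_zero hj0)

/-- Transformation law of `J₁` under `SL₂(ℤ)`. -/
lemma J1ext_modular (hdet : a * d - b * c = 1) (hτ : 0 < τ.im) (hτ' : 0 < τ'.im)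
    (hj : j = c * τ + d) (hτj : τ' * j = a * τ + b) {z : ℂ} (hz : z ∉ periodLattice τ) :
    J1ext τ' (z / j) = j * J1ext τ z + c * z := by
  have hj0 := automorphyFactor_ne_zero hdet hτ hj
  have hmem : ∀ {w : ℂ}, w ∉ periodLattice τ → w / j ∉ periodLattice τ' := fun hw =>
    (div_mem_periodLattice_iff hdet hj hj0 hτj).not.2 hw
  set f : ℂ → ℂ := fun w => J1ext τ' (w / j) - (j * J1ext τ w + c * w) with hf
  obtain ⟨C, hC⟩ : ∃ C, ∀ w ∉ periodLattice τ, f w = C := by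
    refine exists_const_of_elliptic hτ (fun w hw => ?_) (fun w hw m n => ?_) ?_
    · have h1 : DifferentiableAt ℂ (fun w => J1ext τ' (w / j)) w :=
        DifferentiableAt.comp (g := J1ext τ') (f := fun w => w / j) w
          (differentiableAt_Jext hτ' (hmem hw)).1 (by fun_prop)
      exact h1.sub (((differentiableAt_Jext hτ hw).1.const_mul j).add (by fun_prop))
    · simp only [hf]
      rw [add_period_div hdet hj hj0 hτj, J1ext_add_period hτ' (hmem hw), J1ext_add_period hτ hw]
      push_cast
      rw [hj]; ring
    · have h1 := ((tendsto_mul_J1ext hτ').comp (tendsto_div_const_punctured hj0)).const_mul j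
      have h2 := (tendsto_mul_J1ext hτ).const_mul j
      have h3 : Tendsto (fun w : ℂ => c * w ^ 2) (𝓝[≠] 0) (𝓝 0) := by
        have : ContinuousAt (fun w : ℂ => c * w ^ 2) 0 := by fun_prop
        simpa using this.tendsto.mono_left nhdsWithin_le_nhds
      have h4 := (h1.sub h2).sub h3
      rw [sub_self, sub_zero] at h4
      refine h4.congr fun w => ?_
      simp only [Function.comp_apply, hf]
      field_simp
      ring
  have h1 := hC z hz
  have h2 := hC (-z) (neg_mem_periodLattice_iff.not.2 hz)
  simp only [hf] at h1 h2
  rw [neg_div, J1ext_neg (e_ne_one_of_notMem (hmem hz)), J1ext_neg (e_ne_one_of_notMem hz)] at h2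
  linear_combination (h1 - h2) / 2

/-- Transformation law of the Eisenstein series `J₂(τ, 0)` under `SL₂(ℤ)`. -/
lemma J2ext_zero_modular (hdet : a * d - b * c = 1) (hτ : 0 < τ.im) (hτ' : 0 < τ'.im)
    (hj : j = c * τ + d) (hτj : τ' * j = a * τ + b) :
    J2ext τ' 0 = j ^ 2 * J2ext τ 0 + 2 * c * j * (1 / (2 * Real.pi * I)) := by
  have hj0 := automorphyFactor_ne_zero hdet hτ hj
  have hpi := Complex.two_pi_I_ne_zero
  have h1 := (tendsto_J1ext_sub_div hτ').comp (tendsto_div_const_punctured hj0)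
  have h2 := ((tendsto_J1ext_sub_div hτ).const_mul (j ^ 2)).add_const (c * j)
  have h3 := tendsto_nhds_unique (h1.congr' ?_) h2
  · linear_combination (2 / (2 * Real.pi * I)) * h3 +
      (j ^ 2 * J2ext τ 0 - J2ext τ' 0) * mul_inv_cancel₀ hpi
  · filter_upwards [self_mem_nhdsWithin,
      eventually_nhdsWithin_of_eventually_nhds (eventually_notMem_periodLattice_zero hτ)]
      with z hz hmem
    have hz0 : z ≠ 0 := hz
    rw [Function.comp_apply, J1ext_modular hdet hτ hτ' hj hτj (hmem hz)]
    generalize (2 * (Real.pi : ℂ) * I) = y at hpi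
    field_simp
    ring

/-- Transformation law of `J₂` under `SL₂(ℤ)`. -/
lemma J2ext_modular (hdet : a * d - b * c = 1) (hτ : 0 < τ.im) (hτ' : 0 < τ'.im)
    (hj : j = c * τ + d) (hτj : τ' * j = a * τ + b) {z : ℂ} (hz : z ∉ periodLattice τ) :
    J2ext τ' (z / j) = j ^ 2 * J2ext τ z + 2 * c * j * z * J1ext τ z + c ^ 2 * z ^ 2 := by
  have hj0 := automorphyFactor_ne_zero hdet hτ hj
  have hmem : ∀ {w : ℂ}, w ∉ periodLattice τ → w / j ∉ periodLattice τ' := fun hw =>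
    (div_mem_periodLattice_iff hdet hj hj0 hτj).not.2 hw
  have hid : Tendsto (fun w : ℂ => w) (𝓝[≠] 0) (𝓝 0) := tendsto_id.mono_left nhdsWithin_le_nhds
  set f : ℂ → ℂ := fun w =>
    J2ext τ' (w / j) - (j ^ 2 * J2ext τ w + 2 * c * j * (w * J1ext τ w) + c ^ 2 * w ^ 2) with hf
  have hlim : Tendsto f (𝓝[≠] 0) (𝓝 0) := by
    have hJ2 : ∀ {t : ℂ}, 0 < t.im → Tendsto (J2ext t) (𝓝[≠] 0) (𝓝 (J2ext t 0)) := fun ht =>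
      (differentiableAt_J2ext_of_strip ht (by simpa using ht)).continuousAt.tendsto.mono_left
        nhdsWithin_le_nhds
    have h := ((hJ2 hτ').comp (tendsto_div_const_punctured hj0)).sub
      ((((hJ2 hτ).const_mul (j ^ 2)).add ((tendsto_mul_J1ext hτ).const_mul (2 * c * j))).add
        ((hid.pow 2).const_mul ((c : ℂ) ^ 2)))
    rw [J2ext_zero_modular hdet hτ hτ' hj hτj] at h
    simpa using h
  obtain ⟨C, hC⟩ : ∃ C, ∀ w ∉ periodLattice τ, f w = C := by
    refine exists_const_of_elliptic hτ (fun w hw => ?_) (fun w hw m n => ?_) ?_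
    · have h1 : DifferentiableAt ℂ (fun w => J2ext τ' (w / j)) w :=
        DifferentiableAt.comp (g := J2ext τ') (f := fun w => w / j) w
          (differentiableAt_Jext hτ' (hmem hw)).2 (by fun_prop)
      obtain ⟨h2, h3⟩ := differentiableAt_Jext hτ hw
      exact h1.sub (((h3.const_mul (j ^ 2)).add
        ((differentiableAt_id.mul h2).const_mul (2 * c * j))).add (by fun_prop))
    · simp only [hf]
      rw [add_period_div hdet hj hj0 hτj, J2ext_add_period hτ' (hmem hw), J1ext_add_period hτ hw,
        J2ext_add_period hτ hw, J1ext_modular hdet hτ hτ' hj hτj hw]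
      push_cast
      rw [hj]; ring
    · simpa using hid.mul hlim
  have hC0 : C = 0 := by
    refine tendsto_nhds_unique (tendsto_const_nhds.congr' ?_) hlim
    filter_upwards [self_mem_nhdsWithin,
      eventually_nhdsWithin_of_eventually_nhds (eventually_notMem_periodLattice_zero hτ)]
      with w hw hmem
    exact (hC w (hmem hw)).symm
  have := hC z hz
  simp only [hf, hC0] at this
  linear_combination this

end Modular

end JacobiTransformation

/-- transformation law of `J₂` under the Jacobi group. -/
theorem statement10 (a b c d lam mu : ℤ) (hdet : a * d - b * c = 1) (τ z : ℂ)
    (hmem : (τ, z) ∈ D')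
    (hmem' : (((a : ℂ) * τ + (b : ℂ)) / ((c : ℂ) * τ + (d : ℂ)),
      (z + (lam : ℂ) * τ + (mu : ℂ)) / ((c : ℂ) * τ + (d : ℂ))) ∈ D') :
    J2 (((a : ℂ) * τ + (b : ℂ)) / ((c : ℂ) * τ + (d : ℂ)))
        ((z + (lam : ℂ) * τ + (mu : ℂ)) / ((c : ℂ) * τ + (d : ℂ)))
      = ((c : ℂ) * τ + (d : ℂ)) ^ 2 *
          (J2 τ z - 2 * (lam : ℂ) * J1 τ z + (lam : ℂ) ^ 2) +
        2 * (c : ℂ) * ((c : ℂ) * τ + (d : ℂ)) * (z + (lam : ℂ) * τ + (mu : ℂ)) *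
          (J1 τ z - (lam : ℂ)) +
        (c : ℂ) ^ 2 * (z + (lam : ℂ) * τ + (mu : ℂ)) ^ 2 := by
  have hτ : 0 < τ.im := hmem.1
  have hτ' := hmem'.1
  have hj0 := automorphyFactor_ne_zero hdet hτ rfl
  have hz := notMem_of_mem_D' hmem
  have hu := (add_mem_periodLattice_iff lam mu).not.2 hz
  have h := J2ext_modular hdet hτ hτ' rfl (div_mul_cancel₀ _ hj0) hu
  rw [J2ext_add_period hτ hz, J1ext_add_period hτ hz, J2ext_eq hτ' hmem'.2.1,
    J2ext_eq hτ hmem.2.1, J1ext_eq hτ hmem.2.1] at h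
  exact h
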